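/- arXiv:1607.01828 — 9 statements merged into one kernel-verified Lean document; each statement's English description precedes it below -/
import Mathlib

section
/- For every natural number m ≥ 1 there exist natural numbers ℓ1, ℓ2, ℓ3 ≥ 1 and r1, r2, r3 such that for every k with 1 ≤ k ≤ m one has rep ℓ3 r3 (rep ℓ2 r2 (rep ℓ1 r1 k)) = 1; that is, task R(m) can be solved with three nested REPLACE-functions for any m ≥ 1. -/
def rep (l r n : ℕ) : ℕ := (n / l) * r + n % l

/-- Multiples of `m + 1` by factors `1, …, m + 1` all have the same sum of quotient and remainder
modulo `m + 2`. -/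
theorem rep_mul_succ {m k : ℕ} (hk : 1 ≤ k) (hkm : k ≤ m + 1) :
    rep (m + 2) 1 (k * (m + 1)) = m + 1 := by
  obtain ⟨j, rfl⟩ := Nat.exists_eq_add_of_le' hk
  obtain ⟨i, rfl⟩ := Nat.exists_eq_add_of_le (Nat.le_of_succ_le_succ hkm)
  have h : (j + 1) * (j + i + 1) = (i + 1) + (j + i + 2) * j := by ring
  have hlt : i + 1 < j + i + 2 := by omega
  rw [rep, h, Nat.add_mul_div_left _ _ (by omega), Nat.add_mul_mod_self_left,
    Nat.div_eq_of_lt hlt, Nat.mod_eq_of_lt hlt]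
  omega

theorem stmt0 : ∀ m : ℕ, 1 ≤ m →
    ∃ l1 l2 l3 r1 r2 r3 : ℕ, 1 ≤ l1 ∧ 1 ≤ l2 ∧ 1 ≤ l3 ∧
      ∀ k : ℕ, 1 ≤ k → k ≤ m → rep l3 r3 (rep l2 r2 (rep l1 r1 k)) = 1 := by
  intro m _
  refine ⟨1, m + 2, m + 1, m + 1, 1, 1, le_rfl, by omega, by omega, fun k hk hkm => ?_⟩
  have h : rep 1 (m + 1) k = k * (m + 1) := by simp [rep, Nat.mod_one]
  rw [h, rep_mul_succ hk (by omega)]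
  simp [rep]
end

section
/- For every natural number m ≥ 5 and every k with 1 ≤ k ≤ m, rep (m-2) 0 (rep m 1 (rep 1 (m-1) k)) = 1; that is, first replacing 1 by 1^(m-1), then 1^m by 1, then erasing all occurrences of 1^(m-2) solves task R(m). -/
theorem stmt1 : ∀ m : ℕ, 5 ≤ m → ∀ k : ℕ, 1 ≤ k → k ≤ m →
    rep (m - 2) 0 (rep m 1 (rep 1 (m - 1) k)) = 1 := by
  intro m hm k hk hkm
  obtain ⟨j, rfl⟩ := Nat.exists_eq_add_of_le' hk
  obtain ⟨d, rfl⟩ := Nat.exists_eq_add_of_le hkm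
  have h₁ : rep 1 (j + 1 + d - 1) (j + 1) = d + (j + 1 + d) * j := by
    have h : j + 1 + d - 1 = j + d := by omega
    simp only [rep, Nat.div_one, Nat.mod_one, h]
    ring
  have h₂ : rep (j + 1 + d) 1 (d + (j + 1 + d) * j) = 1 + (j + 1 + d - 2) := by
    have hd : d < j + 1 + d := by omega
    rw [rep, Nat.add_mul_div_left _ _ (by omega), Nat.add_mul_mod_self_left,
      Nat.div_eq_of_lt hd, Nat.mod_eq_of_lt hd]
    omega
  rw [h₁, h₂, rep, Nat.mul_zero, Nat.zero_add, Nat.add_mod_right,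
    Nat.mod_eq_of_lt (by omega)]
end

section
/- For every natural number m ≥ 5 and every k with 1 ≤ k ≤ m, rep m 1 (k * (m-1)) = m - 1; that is, blowing up a block of k ones to length k(m-1) = (k-1)m + (m-k) and then replacing occurrences of 1^m by 1 yields a block of exactly m-1 ones. -/
theorem stmt2 : ∀ m : ℕ, 5 ≤ m → ∀ k : ℕ, 1 ≤ k → k ≤ m →
    rep m 1 (k * (m - 1)) = m - 1 := by
  intro m _ k hk hkm
  obtain ⟨j, rfl⟩ := Nat.exists_eq_add_of_le' hk
  obtain ⟨d, rfl⟩ := Nat.exists_eq_add_of_le hkm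
  have hsub : j + 1 + d - 1 = j + d := by omega
  have hdecomp : (j + 1) * (j + d) = d + (j + 1 + d) * j := by ring
  have hlt : d < j + 1 + d := by omega
  rw [rep, hsub, hdecomp, Nat.add_mul_div_left _ _ (by omega), Nat.add_mul_mod_self_left,
    Nat.div_eq_of_lt hlt, Nat.mod_eq_of_lt hlt]
  omega
end

section
/- For all natural numbers ℓ ≥ 1 and r ≥ 0, there exists k with 1 ≤ k ≤ 3 such that rep ℓ r k ≠ 1; that is, task R(3) cannot be solved with a single REPLACE-function. -/
theorem stmt3 : ∀ l r : ℕ, 1 ≤ l →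
    ∃ k : ℕ, 1 ≤ k ∧ k ≤ 3 ∧ rep l r k ≠ 1 := by
  intro l r hl
  by_contra! h
  have h1 := h 1 (by norm_num) (by norm_num)
  have h2 := h 2 (by norm_num) (by norm_num)
  have h3 := h 3 (by norm_num) (by norm_num)
  unfold rep at h1 h2 h3
  obtain hl2 | hl3 := Nat.lt_or_ge 2 l
  · rw [Nat.div_eq_of_lt hl2, Nat.mod_eq_of_lt hl2] at h2
    omega
  · interval_cases l <;> omega
end

section
/- For all natural numbers ℓ1, ℓ2 ≥ 1 and r1, r2 ≥ 0, there exists k with 1 ≤ k ≤ 5 such that rep ℓ2 r2 (rep ℓ1 r1 k) ≠ 1; that is, task R(5) cannot be solved with two nested REPLACE-functions. -/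
theorem rep_eq_one_cases {l r n : ℕ} (hl : 1 ≤ l) (h : rep l r n = 1) :
    (r = 0 ∧ 2 ≤ l ∧ (l : ℤ) ∣ n - 1) ∨ (r ≠ 0 ∧ (n = 1 ∨ n = l)) := by
  unfold rep at h
  have hdiv := Nat.div_add_mod n l
  rcases Nat.eq_zero_or_pos r with rfl | hr
  · left
    have hmod : n % l = 1 := by simpa using h
    have hlt := Nat.mod_lt n hl
    refine ⟨rfl, by omega, (n / l : ℕ), ?_⟩
    rw [hmod] at hdiv
    have : (n : ℤ) = l * (n / l : ℕ) + 1 := by exact_mod_cast hdiv.symm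
    linarith
  · rcases Nat.eq_zero_or_pos (n / l) with hq | hq
    · refine Or.inr ⟨hr.ne', Or.inl ?_⟩
      simp only [hq, zero_mul, zero_add, mul_zero] at h hdiv
      omega
    · refine Or.inr ⟨hr.ne', Or.inr ?_⟩
      have hpos : 0 < n / l * r := Nat.mul_pos hq hr
      have hprod : n / l * r = 1 := by omega
      have hq1 := Nat.dvd_one.mp (Dvd.intro r hprod)
      rw [hq1, mul_one] at hdiv
      omega

theorem stmt4 : ∀ l1 l2 r1 r2 : ℕ, 1 ≤ l1 → 1 ≤ l2 →
    ∃ k : ℕ, 1 ≤ k ∧ k ≤ 5 ∧ rep l2 r2 (rep l1 r1 k) ≠ 1 := by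
  intro l1 l2 r1 r2 hl1 hl2
  by_contra! H
  have key (k : ℕ) (h1 : 1 ≤ k) (h5 : k ≤ 5) := rep_eq_one_cases hl2 (H k h1 h5)
  have k1 := key 1 (by norm_num) (by norm_num)
  have k2 := key 2 (by norm_num) (by norm_num)
  have k3 := key 3 (by norm_num) (by norm_num)
  have k4 := key 4 (by norm_num) (by norm_num)
  have k5 := key 5 (by norm_num) (by norm_num)
  have values (k : ℕ) (hk : k < l1) : rep l1 r1 k = k := by
    simp [rep, Nat.div_eq_of_lt hk, Nat.mod_eq_of_lt hk]
  have not_dvd_one (hl : 2 ≤ l2) (h : (l2 : ℤ) ∣ 1) : False := by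
    have := Int.le_of_dvd one_pos h
    omega
  obtain rfl | rfl | rfl | h : l1 = 1 ∨ l1 = 2 ∨ l1 = 3 ∨ 4 ≤ l1 := by omega
  · norm_num [rep] at k1 k2 k3
    rcases k1 with ⟨hr, hl, h1⟩ | k1
    · rcases k2 with ⟨-, -, h2⟩ | k2
      · apply not_dvd_one hl
        convert dvd_sub h2 (h1.mul_left 2) using 2
        · rfl
        · ring
      · exact k2.1 hr
    · omega
  · norm_num [rep] at k2 k3 k4 k5
    rcases k2 with ⟨hr, hl, h2⟩ | k2
    · rcases k3 with ⟨-, -, h3⟩ | k3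
      · apply not_dvd_one hl
        convert dvd_sub h3 h2 using 2
        · rfl
        · ring
      · exact k3.1 hr
    · omega
  · norm_num [rep] at k2 k3 k4 k5
    rcases k2 with ⟨hr, hl, h2⟩ | k2
    · exact not_dvd_one hl h2
    · omega
  · rw [values 2 (by omega)] at k2
    rw [values 3 (by omega)] at k3
    rcases k2 with ⟨hr, hl, h2⟩ | k2
    · exact not_dvd_one hl (by simpa using h2)
    · omega
end

section
/- Let m ≥ 2, ℓ ≥ 1, r ≥ 2 and g : ℕ → ℕ. If the composition rep ℓ r ∘ g solves R(m), then g alone solves R(m); that is, an outer-most REPLACE whose substituted string consists of more than one symbol is redundant in a solution of R(m). -/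
theorem eq_one_of_rep_eq_one {l r n : ℕ} (hr : 2 ≤ r) (h : rep l r n = 1) : n = 1 := by
  unfold rep at h
  have hq : n / l = 0 := by
    by_contra hne
    have : 1 * 2 ≤ n / l * r := Nat.mul_le_mul (Nat.one_le_iff_ne_zero.mpr hne) hr
    omega
  have hn := Nat.div_add_mod n l
  simp only [hq, zero_mul, mul_zero, zero_add] at h hn
  exact hn.symm.trans h

theorem stmt8 : ∀ m l r : ℕ, 2 ≤ m → 1 ≤ l → 2 ≤ r → ∀ g : ℕ → ℕ,
    (∀ k : ℕ, 1 ≤ k → k ≤ m → rep l r (g k) = 1) →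
    ∀ k : ℕ, 1 ≤ k → k ≤ m → g k = 1 := by
  intro m l r _ _ hr g hg k hk hkm
  exact eq_one_of_rep_eq_one hr (hg k hk hkm)
end

section
/- Let ℓ ≥ 2 and 1 ≤ r < ℓ, and let m ≥ 1. Then the image of the set {1, 2, ..., m} under rep ℓ r is exactly the set {1, 2, ..., M}, where M is the maximum value of rep ℓ r on {1, 2, ..., m}; that is, a length-decreasing REPLACE maps its input to strings covering a consecutive range of lengths starting at 1. -/
theorem rep_mul_add {l r s : ℕ} (hs : s < l) (q : ℕ) : rep l r (l * q + s) = q * r + s := by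
  have hl : 0 < l := by omega
  simp [rep, Nat.mul_add_div hl, Nat.div_eq_of_lt hs, Nat.mod_eq_of_lt hs]

theorem rep_succ_le {l r : ℕ} (hl : 0 < l) (hr : r ≤ l) (n : ℕ) :
    rep l r (n + 1) ≤ rep l r n + 1 := by
  obtain ⟨q, s, hs, rfl⟩ : ∃ q s, s < l ∧ n = l * q + s :=
    ⟨n / l, n % l, Nat.mod_lt n hl, (Nat.div_add_mod n l).symm⟩
  rw [rep_mul_add hs]
  rcases Nat.lt_or_ge (s + 1) l with h | h
  · rw [add_assoc, rep_mul_add h, add_assoc]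
  · have hsl : l * q + s + 1 = l * (q + 1) + 0 := by
      rw [mul_add]
      omega
    rw [hsl, rep_mul_add hl, add_mul]
    omega

theorem rep_pos {l r n : ℕ} (hr : 0 < r) (hn : 0 < n) : 0 < rep l r n := by
  unfold rep
  rcases Nat.eq_zero_or_pos (n / l) with h | h
  · have := Nat.div_add_mod n l
    rw [h, mul_zero] at this
    omega
  · have := Nat.mul_pos h hr
    omega

theorem exists_rep_eq {l r : ℕ} (hl : 0 < l) (hr : r ≤ l) {n y : ℕ} (hy : 1 ≤ y)
    (hyn : y ≤ rep l r n) : ∃ k, 1 ≤ k ∧ k ≤ n ∧ rep l r k = y := by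
  induction n with
  | zero =>
    simp [rep] at hyn
    omega
  | succ n ih =>
    rcases Nat.lt_or_ge (rep l r n) y with h | h
    · have := rep_succ_le hl hr n
      exact ⟨n + 1, by omega, le_rfl, by omega⟩
    · obtain ⟨k, hk, hkn, hky⟩ := ih h
      exact ⟨k, hk, by omega, hky⟩

theorem stmt13 : ∀ l r m : ℕ, 2 ≤ l → 1 ≤ r → r < l → 1 ≤ m →
    (Finset.Icc 1 m).image (rep l r) =
      Finset.Icc 1 ((Finset.Icc 1 m).sup (rep l r)) := by
  intro l r m hl hr hrl hm
  ext y
  simp only [Finset.mem_image, Finset.mem_Icc]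
  constructor
  · rintro ⟨k, hk, rfl⟩
    exact ⟨rep_pos hr hk.1, Finset.le_sup (f := rep l r) (Finset.mem_Icc.2 hk)⟩
  · rintro ⟨hy, hym⟩
    obtain ⟨n, hn, hsup⟩ :=
      Finset.exists_mem_eq_sup (Finset.Icc 1 m) (Finset.nonempty_Icc.2 hm) (rep l r)
    obtain ⟨k, hk, hkn, hky⟩ := exists_rep_eq (by omega) hrl.le hy (hsup ▸ hym)
    exact ⟨k, ⟨hk, hkn.trans (Finset.mem_Icc.1 hn).2⟩, hky⟩
end

section
/- For all natural numbers ℓ1, ℓ2, ℓ3 and r1, r2, r3 with r1 < ℓ1, r2 < ℓ2 and r3 < ℓ3, there exists k with 1 ≤ k ≤ 11 such that rep ℓ3 r3 (rep ℓ2 r2 (rep ℓ1 r1 k)) ≠ 1; that is, task R(11) cannot be solved with three nested length-decreasing REPLACE-functions, so R(10) is the maximal task solvable with three length-decreasing replacements. -/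
theorem rep_of_lt {l n : ℕ} (r : ℕ) (h : n < l) : rep l r n = n := by
  simp [rep, Nat.div_eq_of_lt h, Nat.mod_eq_of_lt h]

/-- A length-decreasing replacement does not increase the length. -/
theorem rep_le {l r : ℕ} (h : r < l) (n : ℕ) : rep l r n ≤ n :=
  calc n / l * r + n % l ≤ n / l * l + n % l := by gcongr
    _ = n := Nat.div_add_mod' n l

/-- On blocks of length less than `N`, every length-decreasing replacement agrees with
one whose pattern has length at most `N`. -/
theorem exists_rep_eq_of_lt {N l r : ℕ} (hN : 0 < N) (h : r < l) :
    ∃ l' < N + 1, ∃ r' < l', ∀ n < N, rep l r n = rep l' r' n := by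
  by_cases hl : l ≤ N
  · exact ⟨l, by lia, r, h, fun _ _ => rfl⟩
  · exact ⟨N, by lia, 0, hN, fun n hn => by rw [rep_of_lt r (by lia), rep_of_lt 0 hn]⟩

theorem rep_zero (l r : ℕ) : rep l r 0 = 0 := by
  simp [rep]

theorem rep_two_ne_one_or_rep_three_ne_one {l r : ℕ} (h : r < l) :
    rep l r 2 ≠ 1 ∨ rep l r 3 ≠ 1 := by
  by_cases hl : 2 < l
  · exact Or.inl (by rw [rep_of_lt r hl]; norm_num)
  · have hl2 : l ≤ 2 := by lia
    interval_cases l <;> interval_cases r <;> decide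

theorem all_any_rep_rep :
    ((List.range 13).all fun l1 => (List.range l1).all fun r1 =>
      (List.range 13).all fun l2 => (List.range l2).all fun r2 =>
        ((List.range 11).any fun k => (rep l2 r2 (rep l1 r1 (k + 1))).beq 0) ||
        (((List.range 11).any fun k => (rep l2 r2 (rep l1 r1 (k + 1))).beq 2) &&
          ((List.range 11).any fun k => (rep l2 r2 (rep l1 r1 (k + 1))).beq 3))) = true := by
  decide +kernel

/-- Two length-decreasing replacements on blocks of length `1, …, 11` attain either the
value `0` or both values `2` and `3`. -/
theorem exists_rep_rep_eq {l1 r1 l2 r2 : ℕ} (h1 : r1 < l1) (h2 : r2 < l2) :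
    (∃ k < 11, rep l2 r2 (rep l1 r1 (k + 1)) = 0) ∨
      (∃ k < 11, rep l2 r2 (rep l1 r1 (k + 1)) = 2) ∧
        ∃ k < 11, rep l2 r2 (rep l1 r1 (k + 1)) = 3 := by
  obtain ⟨m1, hm1, s1, hs1, e1⟩ := exists_rep_eq_of_lt (N := 12) (by norm_num) h1
  obtain ⟨m2, hm2, s2, hs2, e2⟩ := exists_rep_eq_of_lt (N := 12) (by norm_num) h2
  have key : ∀ k < 11, rep l2 r2 (rep l1 r1 (k + 1)) = rep m2 s2 (rep m1 s1 (k + 1)) := by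
    intro k hk
    have hle := rep_le hs1 (k + 1)
    rw [e1 _ (by lia), e2 _ (by lia)]
  have h := all_any_rep_rep
  simp only [List.all_eq_true, List.any_eq_true, List.mem_range, Bool.or_eq_true,
    Bool.and_eq_true, Nat.beq_eq] at h
  rcases h m1 hm1 s1 hs1 m2 hm2 s2 hs2 with ⟨k, hk, e⟩ | ⟨⟨k, hk, e⟩, j, hj, e'⟩
  · exact Or.inl ⟨k, hk, (key k hk).trans e⟩
  · exact Or.inr ⟨⟨k, hk, (key k hk).trans e⟩, j, hj, (key j hj).trans e'⟩

theorem stmt15 : ∀ l1 l2 l3 r1 r2 r3 : ℕ, r1 < l1 → r2 < l2 → r3 < l3 →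
    ∃ k : ℕ, 1 ≤ k ∧ k ≤ 11 ∧ rep l3 r3 (rep l2 r2 (rep l1 r1 k)) ≠ 1 := by
  intro l1 l2 l3 r1 r2 r3 h1 h2 h3
  rcases exists_rep_rep_eq h1 h2 with ⟨k, hk, e⟩ | ⟨⟨k, hk, e⟩, j, hj, e'⟩
  · exact ⟨k + 1, by lia, by lia, by rw [e, rep_zero]; norm_num⟩
  · rcases rep_two_ne_one_or_rep_three_ne_one h3 with h | h
    · exact ⟨k + 1, by lia, by lia, by rwa [e]⟩
    · exact ⟨j + 1, by lia, by lia, by rwa [e']⟩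
end

section
/- For all natural numbers ℓ1, ℓ2, ℓ3, ℓ4 and r1, r2, r3, r4 with r1 < ℓ1, r2 < ℓ2, r3 < ℓ3 and r4 < ℓ4, there exists k with 1 ≤ k ≤ 41 such that rep ℓ4 r4 (rep ℓ3 r3 (rep ℓ2 r2 (rep ℓ1 r1 k))) ≠ 1; that is, task R(41) cannot be solved with four nested length-decreasing REPLACE-functions, so R(40) is the maximal task solvable with four length-decreasing replacements. -/
/-- Every length-decreasing replacement with `l ≤ M` either erases some block of length in `[1, m]`,
or maps the blocks of length in `[1, m]` onto all blocks of length in `[1, M]`. -/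
def CoversShort (m M : ℕ) : Prop :=
  ∀ l < M + 1, ∀ r < l, (∃ k < m + 1, 1 ≤ k ∧ rep l r k = 0) ∨
    ∀ j < M + 1, 1 ≤ j → ∃ k < m + 1, 1 ≤ k ∧ rep l r k = j

instance (m M : ℕ) : Decidable (CoversShort m M) := by
  unfold CoversShort; infer_instance

theorem CoversShort.solves_of_solves_rep {m M l r : ℕ} {g : ℕ → ℕ} (h : CoversShort m M)
    (hM : M ≤ m) (hr : r < l) (hg : g 0 = 0) (H : ∀ k, 1 ≤ k → k ≤ m → g (rep l r k) = 1) :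
    ∀ k, 1 ≤ k → k ≤ M → g k = 1 := by
  intro j hj hjM
  rcases lt_or_ge M l with hl | hl
  · rw [← rep_of_lt r (show j < l by omega)]
    exact H j hj (by omega)
  · rcases h l (by omega) r hr with ⟨k, hk, hk1, h0⟩ | hc
    · have := H k hk1 (by omega)
      rw [h0, hg] at this
      omega
    · obtain ⟨k, hk, hk1, rfl⟩ := hc j (by omega) hj
      exact H k hk1 (by omega)

theorem stmt17 : ∀ l1 l2 l3 l4 r1 r2 r3 r4 : ℕ,
    r1 < l1 → r2 < l2 → r3 < l3 → r4 < l4 →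
    ∃ k : ℕ, 1 ≤ k ∧ k ≤ 41 ∧
      rep l4 r4 (rep l3 r3 (rep l2 r2 (rep l1 r1 k))) ≠ 1 := by
  intro l1 l2 l3 l4 r1 r2 r3 r4 h1 h2 h3 h4
  by_contra! H
  have c1 : CoversShort 41 11 := by decide +kernel
  have c2 : CoversShort 11 5 := by decide +kernel
  have c3 : CoversShort 5 3 := by decide +kernel
  have c4 : CoversShort 3 2 := by decide +kernel
  have H2 := c1.solves_of_solves_rep (g := fun n => rep l4 r4 (rep l3 r3 (rep l2 r2 n)))
    (by omega) h1 (by simp [rep_zero]) H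
  have H3 := c2.solves_of_solves_rep (g := fun n => rep l4 r4 (rep l3 r3 n))
    (by omega) h2 (by simp [rep_zero]) H2
  have H4 := c3.solves_of_solves_rep (g := fun n => rep l4 r4 n)
    (by omega) h3 (by simp [rep_zero]) H3
  have H5 := c4.solves_of_solves_rep (g := fun n => n) (by omega) h4 rfl H4
  exact absurd (H5 2 (by omega) le_rfl) (by omega)
end
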